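/- arXiv:1207.0765 — 2 statements merged into one kernel-verified Lean document; each statement's English description precedes it below -/
import Mathlib

section
/- Let a : ℕ → ℕ be the strictly increasing enumeration of the set {x ∈ ℕ : ∃ y ≥ x, (x, y) is a P-position of Maharaja Nim}, and for each n let b_n ≥ a_n be the (unique) number such that (a_n, b_n) is a P-position. Then for all n ∈ ℕ, n − 4 ≤ b_n − a_n ≤ n + 3 (as integers). -/
/-- One move of Maharaja Nim: from `p` to `q` by a Nim move (decrease one
coordinate), a diagonal move (decrease both by the same positive amount), or a
Knight move `(1,2)` or `(2,1)`. -/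
def MahMove (p q : ℕ × ℕ) : Prop :=
  (∃ k, 0 < k ∧ q.1 + k = p.1 ∧ q.2 = p.2) ∨
  (∃ k, 0 < k ∧ q.1 = p.1 ∧ q.2 + k = p.2) ∨
  (∃ k, 0 < k ∧ q.1 + k = p.1 ∧ q.2 + k = p.2) ∨
  (q.1 + 1 = p.1 ∧ q.2 + 2 = p.2) ∨
  (q.1 + 2 = p.1 ∧ q.2 + 1 = p.2)

theorem MahMove.lt {p q : ℕ × ℕ} (h : MahMove p q) : q.1 + q.2 < p.1 + p.2 := by
  rcases h with ⟨k, hk, h1, h2⟩ | ⟨k, hk, h1, h2⟩ | ⟨k, hk, h1, h2⟩ | ⟨h1, h2⟩ | ⟨h1, h2⟩ <;> omega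

/-- The P-positions of Maharaja Nim: `p` is P iff every move from `p` leads to
a non-P position. -/
def MahP (p : ℕ × ℕ) : Prop :=
  ∀ q, MahMove p q → ¬ MahP q
termination_by p.1 + p.2
decreasing_by exact MahMove.lt ‹_›

namespace Mah

/-- Transducer states. -/
structure Nd where
  dm : ℕ
  rm : ℕ
  p1 : ℕ
  p2 : ℕ
  cnt : ℕ
  iw : ℕ
  ow : ℕ
  deriving DecidableEq

/-- The bit mask of admissible length-7 windows. -/
def SS : ℕ := 4025076436358760148551043197561670423

def fz : ℕ → ℕ → ℕ
  | 0, _ => 0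
  | f + 1, m => if m % 2 = 1 then fz f (m / 2) + 1 else 0

def em : ℕ → ℕ → ℕ → ℕ
  | 0, _, o => o
  | j + 1, rm, o => em j (rm / 2) ((2 * o + rm % 2) % 64)

def emok : ℕ → ℕ → ℕ → Bool
  | 0, _, _ => true
  | j + 1, rm, o => SS.testBit (2 * o + rm % 2) && emok j (rm / 2) ((2 * o + rm % 2) % 64)

def step0 (s : Nd) : Nd :=
  ⟨s.dm, s.rm >>> 1, 0, s.p1 >>> 2, s.cnt, (2 * s.iw + 1) % 64, em 1 s.rm s.ow⟩

def blk (s : Nd) : ℕ := s.dm ||| s.rm ||| s.p1 ||| s.p2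
def kk (s : Nd) : ℕ := fz 64 (blk s)
def dm1 (s : Nd) : ℕ := s.dm ||| 1 <<< kk s
def rm1 (s : Nd) : ℕ := s.rm ||| 1 <<< kk s
def jj (s : Nd) : ℕ := fz 64 (dm1 s)

def step1 (s : Nd) : Nd :=
  ⟨dm1 s >>> jj s, rm1 s >>> (jj s + 1), (1 <<< (kk s + 1)) >>> jj s, s.p1 >>> (jj s + 2),
    s.cnt + 1 - jj s, (2 * s.iw) % 64, em (jj s + 1) (rm1 s) s.ow⟩

def start : Nd := ⟨0, 0, 1, 0, 0, 14, 28⟩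

def enc (s : Nd) : ℕ :=
  (((((s.dm * 128 + s.rm) * 128 + s.p1) * 128 + s.p2) * 128 + s.cnt) * 128 + s.iw) * 128 + s.ow

def dec (n : ℕ) : Nd :=
  ⟨n / 4398046511104, n / 34359738368 % 128, n / 268435456 % 128, n / 2097152 % 128, n / 16384 % 128,
    n / 128 % 128, n % 128⟩

/-- Codes of the reachable states. -/
def codes : List ℕ :=
  [52, 164, 168, 292, 556, 564, 568, 644, 676, 1060, 1176, 1188, 1192, 1200, 1416, 1424, 1668,
   1672, 1704, 1796, 1828, 1920, 1952, 2180, 2184, 2212, 2308, 2440, 2448, 2464, 2480, 2612, 2820,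
   2840, 3204, 3236, 3464, 3472, 3488, 3844, 4260, 4652, 4740, 4744, 4772, 4868, 4884, 4992, 5008,
   5024, 5288, 5764, 5768, 5808, 6536, 7332, 268435474, 268435730, 268435746, 268435986,
   268436498, 268436514, 268436530, 268436754, 268436770, 268437010, 268437250, 268437276,
   268437522, 268437762, 268437778, 268437794, 268438274, 268438306, 268438786, 268438802,
   268438818, 268439058, 268439298, 268439826, 268439842, 268440082, 268440322, 268440354,
   268440594, 268441106, 268441122, 268441874, 268442370, 268442402, 268443154, 8796093038646,
   8796093038764, 8796093038870, 8796093039164, 8796093039276, 8796093039800, 8796093040024,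
   8796093040512, 8796093040520, 8796093041042, 8796093041072, 8796093042966, 8796093043616,
   8796093043620, 8796093045138, 8796095135881, 8796095136905, 8796095137929, 8796095138953,
   8796095139977, 8796095141001, 8796095142025, 8796095143049, 8831526518820, 8831526519300,
   8831526519332, 8831526519844, 8831526520324, 8831526520836, 8831526520868, 8831526521348,
   8831526521380, 8831526521860, 8831526521892, 8831526522372, 8831526522424, 8831526522916,
   8831526523396, 8831526523428, 8831526524420, 8831526525444, 8831526525476, 8831526525988,
   8831526526468, 26388279100809, 26422643032740, 26422643036836, 26459146060050, 26459146062098,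
   26459146064146, 26459146066194, 44014824882348, 44049193009174, 44049193009298, 44049193011346,
   44049193013270, 44049193013394, 44049193015442, 44049193015458, 44122201161737, 44122201162761,
   44122201163785, 44122201164809, 44122201165833, 44122201166857, 44122201167881, 44122201168905,
   44122201168945, 61643518165273, 61714385126665, 185027224715428, 185027224719492,
   185027224719524, 185353617063954, 185353617066002, 185353617068050, 185353617070098,
   185353617070114, 202518445490441]

def memb : List ℕ → ℕ → Bool
  | [], _ => false
  | a :: l, n => bif Nat.beq n a then true else memb l n

theorem memb_mem {l : List ℕ} {n : ℕ} (h : memb l n = true) : n ∈ l := by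
  induction l with
  | nil => simp [memb] at h
  | cons a l ih =>
    rw [memb] at h
    cases hb : Nat.beq n a with
    | true => simp [Nat.eq_of_beq_eq_true hb]
    | false => rw [hb] at h; exact List.mem_cons_of_mem _ (ih h)

def TT (s : Nd) : Prop := memb codes (enc s) = true ∧ dec (enc s) = s

instance (s : Nd) : Decidable (TT s) := by unfold TT; infer_instance

def chk (s : Nd) : Prop :=
  (SS.testBit (2 * s.iw + 1) = true → TT (step0 s) ∧ emok 1 s.rm s.ow = true) ∧
  (SS.testBit (2 * s.iw) = true → TT (step1 s) ∧ emok (jj s + 1) (rm1 s) s.ow = true ∧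
    (blk s).testBit (kk s) = false ∧ (∀ i < kk s, (blk s).testBit i = true) ∧
    (∀ i < jj s, (dm1 s).testBit i = true) ∧ jj s ≤ s.cnt + 1 ∧
    s.cnt ≤ kk s + 4 ∧ kk s ≤ s.cnt + 3)

instance (s : Nd) : Decidable (chk s) := by unfold chk; infer_instance

theorem start_mem : TT start := by decide +kernel
theorem all_codes : ∀ n ∈ codes, chk (dec n) := by decide +kernel

theorem all_chk (s : Nd) (h : TT s) : chk s := by
  rw [← h.2]
  exact all_codes _ (memb_mem h.1)

abbrev P (x y : ℕ) : Prop := MahP (x, y)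

theorem P_iff (x y : ℕ) : P x y ↔ ∀ q, MahMove (x, y) q → ¬ MahP q := by
  unfold P; rw [MahP]

theorem move_symm {p q : ℕ × ℕ} (h : MahMove p q) : MahMove p.swap q.swap := by
  rcases h with ⟨k, hk, h1, h2⟩ | ⟨k, hk, h1, h2⟩ | ⟨k, hk, h1, h2⟩ | ⟨h1, h2⟩ | ⟨h1, h2⟩
  · exact Or.inr (Or.inl ⟨k, hk, h2, h1⟩)
  · exact Or.inl ⟨k, hk, h2, h1⟩
  · exact Or.inr (Or.inr (Or.inl ⟨k, hk, h2, h1⟩))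
  · exact Or.inr (Or.inr (Or.inr (Or.inr ⟨h2, h1⟩)))
  · exact Or.inr (Or.inr (Or.inr (Or.inl ⟨h2, h1⟩)))

theorem P_symm_aux (n : ℕ) : ∀ x y, x + y = n → P x y → P y x := by
  induction n using Nat.strong_induction_on with
  | _ n ih =>
    intro x y hn h
    rw [P_iff] at h ⊢
    rintro ⟨u, v⟩ hm hP
    have hlt := hm.lt
    simp only at hlt
    exact h (v, u) (move_symm hm) (ih (u + v) (by omega) u v rfl hP)

theorem P_symm {x y : ℕ} (h : P x y) : P y x := P_symm_aux _ x y rfl h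

theorem P_row {x x' y : ℕ} (h : P x y) (h' : P x' y) (hl : x' < x) : False :=
  (P_iff x y).1 h (x', y) (Or.inl ⟨x - x', by omega, by simp; omega, rfl⟩) h'

theorem P_col {x y y' : ℕ} (h : P x y) (h' : P x y') (hl : y' < y) : False :=
  (P_iff x y).1 h (x, y') (Or.inr (Or.inl ⟨y - y', by omega, rfl, by simp; omega⟩)) h'

theorem P_diag {x x' d : ℕ} (h : P x (x + d)) (h' : P x' (x' + d)) (hl : x' < x) : False :=
  (P_iff x _).1 h (x', x' + d)
    (Or.inr (Or.inr (Or.inl ⟨x - x', by omega, by simp; omega, by simp; omega⟩))) h'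

theorem P_k1 {x y : ℕ} (h : P (x + 1) (y + 2)) (h' : P x y) : False :=
  (P_iff _ _).1 h (x, y) (Or.inr (Or.inr (Or.inr (Or.inl ⟨rfl, rfl⟩)))) h'

theorem P_k2 {x y : ℕ} (h : P (x + 2) (y + 1)) (h' : P x y) : False :=
  (P_iff _ _).1 h (x, y) (Or.inr (Or.inr (Or.inr (Or.inr ⟨rfl, rfl⟩)))) h'

theorem P00 : P 0 0 := by
  rw [P_iff]
  intro q h
  have := h.lt
  simp at this

def R (z : ℕ) : Prop := ∃ x' < z, P x' z

open Classical in
noncomputable def r (z : ℕ) : ℕ := if R z then 1 else 0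

noncomputable def c : ℕ → ℕ
  | 0 => 7
  | z + 1 => (2 * c z + r z) % 64

open Classical in
structure Inv (x m : ℕ) (s : Nd) : Prop where
  hm : 1 ≤ m
  dlow : ∀ d < m, ∃ x' < x, P x' (x' + d)
  hdm : ∀ k, s.dm.testBit k = true ↔ ∃ x' < x, P x' (x' + (m + k))
  hrm : ∀ k, s.rm.testBit k = true ↔ ∃ x' < x, P x' (x + m + k)
  hp1 : ∀ k, s.p1.testBit k = true ↔ ∃ x' d, x' + 1 = x ∧ d + 1 = m + k ∧ P x' (x' + d)
  hp2 : ∀ k, s.p2.testBit k = true ↔ ∃ x', x' + 2 = x ∧ P x' (x' + (m + k + 1))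
  hcnt : Nat.count (fun z => ¬ R z) x = m + s.cnt
  hiw : s.iw = c x
  how : s.ow = c (x + m)
  hwin : ∀ z, 1 ≤ z → z < x + m → SS.testBit (2 * c z + r z) = true

theorem blk_iff (s : Nd) (k : ℕ) : (blk s).testBit k = true ↔
    s.dm.testBit k = true ∨ s.rm.testBit k = true ∨ s.p1.testBit k = true ∨
      s.p2.testBit k = true := by
  simp [blk, Nat.testBit_or, or_assoc]

theorem not_P_of_R {x d : ℕ} (h : R x) : ¬ P x (x + d) := by
  obtain ⟨x', hl, hP⟩ := h
  intro h
  exact P_col h (P_symm hP) (by omega)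

theorem blk_not {x m k : ℕ} {s : Nd} (I : Inv x m s) (h : (blk s).testBit k = true) :
    ¬ P x (x + (m + k)) := by
  intro hP
  rw [blk_iff, I.hdm, I.hrm, I.hp1, I.hp2] at h
  rcases h with ⟨x', hl, h⟩ | ⟨x', hl, h⟩ | ⟨x', d, rfl, hd, h⟩ | ⟨x', rfl, h⟩
  · exact P_diag hP h hl
  · rw [add_assoc] at h
    exact P_row hP h hl
  · refine P_k1 (x := x') (y := x' + d) ?_ h
    rwa [show x' + d + 2 = x' + 1 + (m + k) by omega]
  · refine P_k2 (x := x') (y := x' + (m + k + 1)) ?_ h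
    rwa [show x' + (m + k + 1) + 1 = x' + 2 + (m + k) by omega]

theorem P_of {x m k : ℕ} {s : Nd} (I : Inv x m s) (hR : ¬ R x)
    (h : (blk s).testBit k = false) (hk : ∀ i < k, (blk s).testBit i = true) :
    P x (x + (m + k)) := by
  have hm := I.hm
  have hb : ¬ ((blk s).testBit k = true) := by simp [h]
  rw [blk_iff, I.hdm, I.hrm, I.hp1, I.hp2] at hb
  push Not at hb
  obtain ⟨b1, b2, b3, b4⟩ := hb
  rw [P_iff]
  rintro ⟨u, v⟩ hmv hq
  rcases hmv with ⟨t, ht, h1, h2⟩ | ⟨t, ht, h1, h2⟩ | ⟨t, ht, h1, h2⟩ | ⟨h1, h2⟩ | ⟨h1, h2⟩ <;>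
    simp only at h1 h2
  · refine b2 u (by omega) ?_
    rw [add_assoc, ← h2]; exact hq
  · subst h1
    by_cases hv : v < u
    · exact hR ⟨v, hv, P_symm hq⟩
    · obtain ⟨d, rfl⟩ := Nat.exists_eq_add_of_le (not_lt.1 hv)
      by_cases hd : d < m
      · obtain ⟨x', hl, h'⟩ := I.dlow d hd
        exact P_diag hq h' hl
      · obtain ⟨i, rfl⟩ := Nat.exists_eq_add_of_le (not_lt.1 hd)
        exact blk_not I (hk i (by omega)) hq
  · refine b1 u (by omega) ?_
    have : v = u + (m + k) := by omega
    rw [← this]; exact hq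
  · refine b3 u (m + k - 1) (by omega) (by omega) ?_
    have : v = u + (m + k - 1) := by omega
    rw [← this]; exact hq
  · refine b4 u (by omega) ?_
    have : v = u + (m + k + 1) := by omega
    rw [← this]; exact hq

theorem P_iff_k {x m k : ℕ} {s : Nd} (I : Inv x m s) (hR : ¬ R x)
    (h : (blk s).testBit k = false) (hk : ∀ i < k, (blk s).testBit i = true) (y : ℕ) :
    P x y ↔ y = x + (m + k) := by
  have h0 := P_of I hR h hk
  constructor
  · intro h1
    rcases lt_trichotomy y (x + (m + k)) with h2 | h2 | h2
    · exact (P_col h0 h1 h2).elim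
    · exact h2
    · exact (P_col h1 h0 h2).elim
  · rintro rfl; exact h0

/-- Emission of finalized rows. -/
theorem emit_ok (j : ℕ) : ∀ (rm o y : ℕ), o = c y →
    (∀ k < j, (rm.testBit k = true ↔ R (y + k))) → emok j rm o = true →
    em j rm o = c (y + j) ∧ ∀ z, y ≤ z → z < y + j → SS.testBit (2 * c z + r z) = true := by
  induction j with
  | zero =>
    intro rm o y ho _ _
    exact ⟨by simpa [em] using ho, fun z h1 h2 => by omega⟩
  | succ j ih =>
    intro rm o y ho hb he
    have hr : rm % 2 = r y := by
      have := hb 0 (by omega)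
      simp only [Nat.testBit_zero, decide_eq_true_eq, add_zero] at this
      unfold r
      split_ifs with h
      · exact this.2 h
      · have : ¬ (rm % 2 = 1) := fun h' => h (this.1 h')
        omega
    simp only [emok, Bool.and_eq_true] at he
    rw [hr, ho] at he
    have h2 := ih (rm / 2) ((2 * c y + r y) % 64) (y + 1) (by simp [c])
      (fun k hk => by
        have := hb (k + 1) (by omega)
        rw [Nat.testBit_succ] at this
        rw [this, show y + 1 + k = y + (k + 1) by omega]) he.2
    refine ⟨?_, ?_⟩
    · simp only [em]
      rw [hr, ho, h2.1, show y + 1 + j = y + (j + 1) by omega]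
    · intro z hz1 hz2
      rcases Nat.lt_or_ge y z with h | h
      · exact h2.2 z h (by omega)
      · obtain rfl : y = z := by omega
        exact he.1

theorem R_iff {x m z : ℕ} (hd : ∀ d < m, ∃ x' < x, P x' (x' + d)) (hz : x ≤ z) (hz2 : z < x + m) :
    R z ↔ ∃ x' < x, P x' z := by
  constructor
  · rintro ⟨x', hl, hP⟩
    by_cases h : x' < x
    · exact ⟨x', h, hP⟩
    · obtain ⟨d, rfl⟩ := Nat.exists_eq_add_of_le hl.le
      obtain ⟨x'', hl', hP'⟩ := hd d (by omega)
      exact (P_diag hP hP' (by omega)).elim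
  · rintro ⟨x', hl, hP⟩
    exact ⟨x', by omega, hP⟩

theorem inv_step0 {x m : ℕ} {s : Nd} (hs : TT s) (I : Inv x m s) (hx : 1 ≤ x) (hR : R x) :
    TT (step0 s) ∧ Inv (x + 1) m (step0 s) := by
  classical
  have hm := I.hm
  have hw := I.hwin x hx (by omega)
  have hrx : r x = 1 := by simp [r, hR]
  rw [hrx, ← I.hiw] at hw
  obtain ⟨h1, h2⟩ := (all_chk s hs).1 hw
  have hno : ∀ y, x ≤ y → ¬ P x y := by
    intro y hy
    obtain ⟨d, rfl⟩ := Nat.exists_eq_add_of_le hy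
    exact not_P_of_R hR
  have hdl : ∀ d < m, ∃ x' < x + 1, P x' (x' + d) := fun d hd => by
    obtain ⟨x', h, h'⟩ := I.dlow d hd
    exact ⟨x', by omega, h'⟩
  have hex : ∀ f : ℕ → ℕ, x ≤ f x → ((∃ x' < x + 1, P x' (f x')) ↔ ∃ x' < x, P x' (f x')) := by
    intro f hf
    constructor
    · rintro ⟨x', hl, hP⟩
      rcases Nat.lt_succ_iff_lt_or_eq.1 hl with h | rfl
      · exact ⟨x', h, hP⟩
      · exact (hno _ hf hP).elim
    · rintro ⟨x', hl, hP⟩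
      exact ⟨x', by omega, hP⟩
  obtain ⟨e1, e2⟩ := emit_ok 1 s.rm s.ow (x + m) I.how (fun k hk => by
    rw [I.hrm, R_iff hdl (by omega) (by omega), hex (fun _ => x + m + k) (by omega)]) h2
  refine ⟨h1, ⟨hm, hdl, ?_, ?_, ?_, ?_, ?_, ?_, ?_, ?_⟩⟩
  · intro k
    rw [hex (fun x' => x' + (m + k)) (by omega)]
    exact I.hdm k
  · intro k
    rw [hex (fun _ => x + 1 + m + k) (by omega)]
    simp only [step0, Nat.testBit_shiftRight]
    rw [I.hrm, show x + m + (1 + k) = x + 1 + m + k by omega]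
  · intro k
    simp only [step0, Nat.zero_testBit, Bool.false_eq_true, false_iff]
    rintro ⟨x', d, h, -, hP⟩
    obtain rfl : x' = x := by omega
    exact hno _ (by omega) hP
  · intro k
    simp only [step0, Nat.testBit_shiftRight]
    rw [I.hp1]
    constructor
    · rintro ⟨x', d, h, h', hP⟩
      obtain rfl : d = m + k + 1 := by omega
      exact ⟨x', by omega, hP⟩
    · rintro ⟨x', h, hP⟩
      exact ⟨x', _, by omega, by omega, hP⟩
  · rw [Nat.count_succ, I.hcnt]
    simp [hR, step0]
  · simp [step0, c, hrx, I.hiw]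
  · simp only [step0]
    rw [e1, show x + m + 1 = x + 1 + m by omega]
  · intro z hz1 hz2
    rcases Nat.lt_or_ge z (x + m) with h | h
    · exact I.hwin z hz1 h
    · exact e2 z h (by omega)

theorem inv_col {x m : ℕ} {s : Nd} (hs : TT s) (I : Inv x m s) (hx : 1 ≤ x) (hR : ¬ R x) :
    (∀ y, P x y ↔ y = x + (m + kk s)) ∧ s.cnt ≤ kk s + 4 ∧ kk s ≤ s.cnt + 3 := by
  have hm := I.hm
  have hw := I.hwin x hx (by omega)
  have hrx : r x = 0 := by simp [r, hR]
  rw [hrx, ← I.hiw] at hw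
  obtain ⟨-, -, h3, h4, -, -, h7, h8⟩ := (all_chk s hs).2 hw
  exact ⟨P_iff_k I hR h3 h4, h7, h8⟩

theorem testBit_one_shl (k i : ℕ) : (1 <<< k).testBit i = true ↔ i = k := by
  rw [Nat.one_shiftLeft, Nat.testBit_two_pow]
  simp [eq_comm]

theorem inv_step1 {x m : ℕ} {s : Nd} (hs : TT s) (I : Inv x m s) (hx : 1 ≤ x) (hR : ¬ R x) :
    TT (step1 s) ∧ Inv (x + 1) (m + jj s) (step1 s) := by
  classical
  have hm := I.hm
  have hcol := (inv_col hs I hx hR).1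
  have hw := I.hwin x hx (by omega)
  have hrx : r x = 0 := by simp [r, hR]
  rw [hrx, ← I.hiw] at hw
  obtain ⟨h1, h2, -, -, h5, h6, -, -⟩ := (all_chk s hs).2 hw
  have hex : ∀ f : ℕ → ℕ, ((∃ x' < x + 1, P x' (f x')) ↔
      (∃ x' < x, P x' (f x')) ∨ f x = x + (m + kk s)) := by
    intro f
    constructor
    · rintro ⟨x', hl, hP⟩
      rcases Nat.lt_succ_iff_lt_or_eq.1 hl with h | rfl
      · exact Or.inl ⟨x', h, hP⟩
      · exact Or.inr ((hcol _).1 hP)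
    · rintro (⟨x', hl, hP⟩ | h)
      · exact ⟨x', by omega, hP⟩
      · exact ⟨x, by omega, (hcol _).2 h⟩
  have hdm1 : ∀ k, (dm1 s).testBit k = true ↔ ∃ x' < x + 1, P x' (x' + (m + k)) := by
    intro k
    rw [hex (fun x' => x' + (m + k)), ← I.hdm, dm1, Nat.testBit_or, Bool.or_eq_true,
      testBit_one_shl]
    constructor <;> rintro (h | h) <;> first | exact Or.inl h | (right; omega)
  have hrm1 : ∀ k, (rm1 s).testBit k = true ↔ ∃ x' < x + 1, P x' (x + m + k) := by
    intro k
    rw [hex (fun _ => x + m + k), ← I.hrm, rm1, Nat.testBit_or, Bool.or_eq_true,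
      testBit_one_shl]
    constructor <;> rintro (h | h) <;> first | exact Or.inl h | (right; omega)
  have hdl : ∀ d < m + jj s, ∃ x' < x + 1, P x' (x' + d) := fun d hd => by
    by_cases h : d < m
    · obtain ⟨x', h, h'⟩ := I.dlow d h
      exact ⟨x', by omega, h'⟩
    · obtain ⟨i, rfl⟩ := Nat.exists_eq_add_of_le (not_lt.1 h)
      exact (hdm1 i).1 (h5 i (by omega))
  obtain ⟨e1, e2⟩ := emit_ok (jj s + 1) (rm1 s) s.ow (x + m) I.how (fun k hk => by
    rw [hrm1, R_iff hdl (by omega) (by omega)]) h2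
  refine ⟨h1, ⟨by omega, hdl, ?_, ?_, ?_, ?_, ?_, ?_, ?_, ?_⟩⟩
  · intro k
    simp only [step1, Nat.testBit_shiftRight]
    rw [hdm1, add_assoc]
  · intro k
    simp only [step1, Nat.testBit_shiftRight]
    rw [hrm1, show x + m + (jj s + 1 + k) = x + 1 + (m + jj s) + k by omega]
  · intro k
    simp only [step1, Nat.testBit_shiftRight]
    rw [testBit_one_shl]
    constructor
    · intro h
      exact ⟨x, m + kk s, rfl, by omega, (hcol _).2 rfl⟩
    · rintro ⟨x', d, h, h', hP⟩
      obtain rfl : x' = x := by omega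
      have := (hcol _).1 hP
      omega
  · intro k
    simp only [step1, Nat.testBit_shiftRight]
    rw [I.hp1]
    constructor
    · rintro ⟨x', d, h, h', hP⟩
      obtain rfl : d = m + jj s + k + 1 := by omega
      exact ⟨x', by omega, hP⟩
    · rintro ⟨x', h, hP⟩
      exact ⟨x', _, by omega, by omega, hP⟩
  · rw [Nat.count_succ, I.hcnt]
    simp only [hR, not_false_eq_true, if_true, step1]
    omega
  · simp [step1, c, hrx, I.hiw]
  · simp only [step1]
    rw [e1, show x + m + (jj s + 1) = x + 1 + (m + jj s) by omega]
  · intro z hz1 hz2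
    rcases Nat.lt_or_ge z (x + m) with h | h
    · exact I.hwin z hz1 h
    · exact e2 z h (by omega)

theorem P0_iff (y : ℕ) : P 0 y ↔ y = 0 := by
  constructor
  · intro h
    by_contra hy
    exact P_col h P00 (by omega)
  · rintro rfl; exact P00

theorem not_R0 : ¬ R 0 := by
  rintro ⟨x', h, -⟩; omega

theorem not_R1 : ¬ R 1 := by
  rintro ⟨x', h, hP⟩
  obtain rfl : x' = 0 := by omega
  rw [P0_iff] at hP
  omega

theorem c1 : c 1 = 14 := by
  simp [c, r, not_R0]

theorem c2 : c 2 = 28 := by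
  rw [c, c1]; simp [r, not_R1]

theorem inv_start : Inv 1 1 start := by
  classical
  have hex : ∀ f : ℕ → ℕ, ((∃ x' < 1, P x' (f x')) ↔ f 0 = 0) := by
    intro f
    rw [← P0_iff]
    constructor
    · rintro ⟨x', hl, hP⟩
      obtain rfl : x' = 0 := by omega
      exact hP
    · intro h
      exact ⟨0, by omega, h⟩
  refine ⟨le_rfl, ?_, ?_, ?_, ?_, ?_, ?_, ?_, ?_, ?_⟩
  · intro d hd
    rw [hex (fun x' => x' + d)]; omega
  · intro k
    rw [hex (fun x' => x' + (1 + k))]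
    simp [start]
  · intro k
    rw [hex (fun _ => 1 + 1 + k)]
    simp [start]
  · intro k
    have := testBit_one_shl 0 k
    simp only [Nat.shiftLeft_zero] at this
    simp only [start]
    rw [this]
    constructor
    · rintro rfl
      exact ⟨0, 0, rfl, rfl, P00⟩
    · rintro ⟨x', d, h, h', hP⟩
      obtain rfl : x' = 0 := by omega
      rw [P0_iff] at hP
      omega
  · intro k
    simp only [start, Nat.zero_testBit, Bool.false_eq_true, false_iff]
    rintro ⟨x', h, -⟩
    omega
  · rw [Nat.count_succ]
    simp [not_R0, start]
  · rw [c1]; rfl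
  · rw [c2]; rfl
  · intro z h1 h2
    obtain rfl : z = 1 := by omega
    rw [c1]
    simp only [r, not_R1, if_false]
    decide +kernel

theorem exists_inv (x : ℕ) : ∃ m s, TT s ∧ Inv (x + 1) m s := by
  induction x with
  | zero => exact ⟨1, start, start_mem, inv_start⟩
  | succ x ih =>
    obtain ⟨m, s, hs, I⟩ := ih
    by_cases hR : R (x + 1)
    · exact ⟨_, _, inv_step0 hs I (by omega) hR⟩
    · exact ⟨_, _, inv_step1 hs I (by omega) hR⟩

theorem A_iff (x : ℕ) : (∃ y, x ≤ y ∧ MahP (x, y)) ↔ ¬ R x := by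
  constructor
  · rintro ⟨y, hy, hP⟩ hR
    obtain ⟨d, rfl⟩ := Nat.exists_eq_add_of_le hy
    exact not_P_of_R hR hP
  · intro hR
    cases x with
    | zero => exact ⟨0, le_rfl, P00⟩
    | succ x =>
      obtain ⟨m, s, hs, I⟩ := exists_inv x
      refine ⟨x + 1 + (m + kk s), by omega, ((inv_col hs I (by omega) hR).1 _).2 rfl⟩

open Classical in
theorem count_eq (a : ℕ → ℕ) (p : ℕ → Prop) (ha : StrictMono a)
    (hr : ∀ x, (∃ n, a n = x) ↔ p x) (n : ℕ) : Nat.count p (a n) = n := by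
  rw [Nat.count_eq_card_filter_range]
  have : Finset.filter p (Finset.range (a n)) = (Finset.range n).image a := by
    ext x
    simp only [Finset.mem_filter, Finset.mem_range, Finset.mem_image, ← hr]
    constructor
    · rintro ⟨h, i, rfl⟩
      exact ⟨i, ha.lt_iff_lt.1 h, rfl⟩
    · rintro ⟨i, h, rfl⟩
      exact ⟨ha h, i, rfl⟩
  rw [this, Finset.card_image_of_injective _ ha.injective, Finset.card_range]

end Mah

theorem maharaja_diff_bounds (a b : ℕ → ℕ)
    (ha_mono : StrictMono a)
    (ha_range : ∀ x : ℕ, (∃ n, a n = x) ↔ ∃ y : ℕ, x ≤ y ∧ MahP (x, y))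
    (hb : ∀ n : ℕ, a n ≤ b n ∧ MahP (a n, b n)) :
    ∀ n : ℕ, (n : ℤ) - 4 ≤ (b n : ℤ) - (a n : ℤ) ∧ (b n : ℤ) - (a n : ℤ) ≤ (n : ℤ) + 3 := by
  classical
  intro n
  have hc := Mah.count_eq a (fun z => ¬ Mah.R z) ha_mono
    (fun x => (ha_range x).trans (Mah.A_iff x)) n
  obtain ⟨h1, h2⟩ := hb n
  have hR : ¬ Mah.R (a n) := (Mah.A_iff _).1 ⟨_, h1, h2⟩
  generalize a n = x at *
  generalize b n = y at *
  cases x with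
  | zero =>
    have := (Mah.P0_iff y).1 h2
    simp at hc
    omega
  | succ x =>
    obtain ⟨m, s, hs, I⟩ := Mah.exists_inv x
    obtain ⟨h3, h4, h5⟩ := Mah.inv_col hs I (by omega) hR
    have h6 := (h3 y).1 h2
    have h7 := I.hcnt
    have h8 : n = m + s.cnt := by
      rw [← h7, ← hc]
      congr!
    push_cast
    omega
end

section
/- In Wythoff Nim, for every C ∈ ℕ there is exactly one x ∈ ℕ such that (x, x + C) is a P-position. -/
/-- One move of Wythoff Nim: from `p` to `q` by a Nim move (decrease one
coordinate by a positive amount) or a diagonal move (decrease both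
coordinates by the same positive amount). -/
def WyMove (p q : ℕ × ℕ) : Prop :=
  (∃ k, 0 < k ∧ q.1 + k = p.1 ∧ q.2 = p.2) ∨
  (∃ k, 0 < k ∧ q.1 = p.1 ∧ q.2 + k = p.2) ∨
  (∃ k, 0 < k ∧ q.1 + k = p.1 ∧ q.2 + k = p.2)

theorem WyMove.lt {p q : ℕ × ℕ} (h : WyMove p q) : q.1 + q.2 < p.1 + p.2 := by
  rcases h with ⟨k, hk, h1, h2⟩ | ⟨k, hk, h1, h2⟩ | ⟨k, hk, h1, h2⟩ <;> omega

/-- The P-positions of Wythoff Nim: `p` is P iff every move from `p` leads to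
a non-P position. -/
def WyP (p : ℕ × ℕ) : Prop :=
  ∀ q, WyMove p q → ¬ WyP q
termination_by p.1 + p.2
decreasing_by exact WyMove.lt ‹_›

theorem WyP_iff (p : ℕ × ℕ) : WyP p ↔ ∀ q, WyMove p q → ¬ WyP q := by
  rw [WyP]

theorem WyP_swap_aux (n : ℕ) : ∀ x y : ℕ, x + y = n → WyP (x, y) → WyP (y, x) := by
  induction n using Nat.strong_induction_on with
  | _ n ih =>
    intro x y hn h
    rw [WyP_iff] at h ⊢
    rintro ⟨u, v⟩ hm hq
    have hlt := hm.lt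
    simp only at hlt
    refine h (v, u) ?_ (ih (u + v) (by omega) u v rfl hq)
    rcases hm with ⟨k, hk, h1, h2⟩ | ⟨k, hk, h1, h2⟩ | ⟨k, hk, h1, h2⟩
    · exact Or.inr (Or.inl ⟨k, hk, h2, h1⟩)
    · exact Or.inl ⟨k, hk, h2, h1⟩
    · exact Or.inr (Or.inr ⟨k, hk, h2, h1⟩)

theorem WyP_swap {x y : ℕ} (h : WyP (x, y)) : WyP (y, x) := WyP_swap_aux _ x y rfl h

theorem WyP_row {x y z : ℕ} (h : WyP (x, y)) (h' : WyP (x, z)) : y = z := by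
  rcases lt_trichotomy y z with hl | hl | hl
  · exact absurd h ((WyP_iff _).1 h' _ (Or.inr (Or.inl ⟨z - y, by omega, rfl, by simp only; omega⟩)))
  · exact hl
  · exact absurd h' ((WyP_iff _).1 h _ (Or.inr (Or.inl ⟨y - z, by omega, rfl, by simp only; omega⟩)))

theorem WyP_diag {x y C : ℕ} (h : WyP (x, x + C)) (h' : WyP (y, y + C)) : x = y := by
  rcases lt_trichotomy x y with hl | hl | hl
  · exact absurd h ((WyP_iff _).1 h' _
      (Or.inr (Or.inr ⟨y - x, by omega, by simp only; omega, by simp only; omega⟩)))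
  · exact hl
  · exact absurd h' ((WyP_iff _).1 h _
      (Or.inr (Or.inr ⟨x - y, by omega, by simp only; omega, by simp only; omega⟩)))

theorem WyP_bound (C : ℕ) : ∃ N, ∀ D < C, ∀ x, WyP (x, x + D) → x + D < N := by
  induction C with
  | zero => exact ⟨0, by intro D hD; omega⟩
  | succ C ih =>
    obtain ⟨N, hN⟩ := ih
    by_cases hx : ∃ x, WyP (x, x + C)
    · obtain ⟨x, hx⟩ := hx
      refine ⟨N + x + C + 1, fun D hD y hy => ?_⟩
      rcases Nat.lt_succ_iff_lt_or_eq.1 hD with h | h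
      · have := hN D h y hy
        omega
      · subst h
        have := WyP_diag hx hy
        omega
    · refine ⟨N, fun D hD y hy => ?_⟩
      rcases Nat.lt_succ_iff_lt_or_eq.1 hD with h | h
      · exact hN D h y hy
      · subst h
        exact absurd ⟨y, hy⟩ hx

theorem WyP_exists (C : ℕ) : ∃ x, WyP (x, x + C) := by
  classical
  by_contra hno
  have hex : ∃ m, ¬ ∃ D < C, ∃ x, WyP (x, x + D) ∧ (m = x ∨ m = x + D) := by
    obtain ⟨N, hN⟩ := WyP_bound C
    refine ⟨N, ?_⟩
    rintro ⟨D, hD, x, hx, h⟩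
    have := hN D hD x hx
    omega
  obtain ⟨a, ha, hmin⟩ : ∃ a, (¬ ∃ D < C, ∃ x, WyP (x, x + D) ∧ (a = x ∨ a = x + D)) ∧
      ∀ m < a, ∃ D < C, ∃ x, WyP (x, x + D) ∧ (m = x ∨ m = x + D) :=
    ⟨Nat.find hex, Nat.find_spec hex, fun m hm => not_not.1 (Nat.find_min hex hm)⟩
  -- rows below `a` only contain P-positions at distance less than `C`
  have key : ∀ m < a, ∀ v, WyP (m, v) → v < m + C := by
    intro m hm v hv
    obtain ⟨D, hD, x, hx, h | h⟩ := hmin m hm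
    · subst h
      have := WyP_row hx hv
      omega
    · subst h
      have := WyP_row (WyP_swap hx) hv
      omega
  apply hno
  refine ⟨a, ?_⟩
  rw [WyP_iff]
  rintro ⟨u, v⟩ hm hq
  rcases hm with ⟨k, hk, h1, h2⟩ | ⟨k, hk, h1, h2⟩ | ⟨k, hk, h1, h2⟩ <;> simp only at h1 h2
  · have := key u (by omega) v hq
    omega
  · subst h1
    by_cases huv : u ≤ v
    · obtain ⟨D, rfl⟩ := Nat.exists_eq_add_of_le huv
      exact ha ⟨D, by omega, u, hq, Or.inl rfl⟩
    · have hq' := WyP_swap hq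
      have hk' := key v (by omega) u hq'
      obtain ⟨D, rfl⟩ := Nat.exists_eq_add_of_le (le_of_not_ge huv)
      exact ha ⟨D, by omega, v, hq', Or.inr rfl⟩
  · apply hno
    refine ⟨u, ?_⟩
    have : v = u + C := by omega
    rwa [← this]

theorem wythoff_diagonal_unique (C : ℕ) :
    ∃! x : ℕ, WyP (x, x + C) := by
  obtain ⟨x, hx⟩ := WyP_exists C
  exact ⟨x, hx, fun y hy => WyP_diag hy hx⟩
end
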